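/- (Nonexistence of a smooth flow map: cubic lower bound) Let $\gamma \in \{1,2,3\}$, $s < (\gamma-1)/2$, and for $N \gg 1$ define $f_N \in L^2(\mathbb{R})$ by $\widehat{f_N}(\xi) = N^{-s+1/2}\, \mathbf{1}_{[N - N^{-1},\, N + N^{-1}]}(\xi)$ (so $\|f_N\|_{H^s} \sim 1$). Then $\sup_{0 \le t \le 1} \left\| \int_0^t e^{i(t-t')\partial_x^4}\, \partial_x^{\gamma}\Big( |e^{it'\partial_x^4} f_N|^2\, e^{it'\partial_x^4} f_N \Big) dt' \right\|_{H^s} \ge c\, N^{-2s + \gamma - 1}$ for a positive constant $c$ independent of $N$; in particular the left-hand side tends to $\infty$ as $N \to \infty$. -/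

import Mathlib

open MeasureTheory ENNReal

/-- The Fourier transform `f̂(ξ) = (2π)^{-1/2} ∫ e^{-ixξ} f(x) dx`. -/
noncomputable def paperFT (f : ℝ → ℂ) (ξ : ℝ) : ℂ :=
  ((Real.sqrt (2 * Real.pi) : ℝ) : ℂ)⁻¹ *
    ∫ x : ℝ, Complex.exp (-(Complex.I * ((x * ξ : ℝ) : ℂ))) * f x

/-- The Fourier transform of the data `f_N`:
`f̂_N(ξ) = N^{-s+1/2} 𝟙_{[N-N⁻¹, N+N⁻¹]}(ξ)` (so `‖f_N‖_{H^s} ∼ 1`). -/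
noncomputable def fhatN (s N : ℝ) (ξ : ℝ) : ℂ :=
  ((N ^ (-s + 1 / 2) : ℝ) : ℂ) *
    (Set.Icc (N - N⁻¹) (N + N⁻¹)).indicator (fun _ => (1 : ℂ)) ξ

/-- The free evolution `U(t,x) = (e^{it∂ₓ⁴} f_N)(x)`. -/
noncomputable def freeUN (s N : ℝ) (t x : ℝ) : ℂ :=
  ((Real.sqrt (2 * Real.pi) : ℝ) : ℂ)⁻¹ *
    ∫ ξ : ℝ, Complex.exp (Complex.I * ((x * ξ + t * ξ ^ 4 : ℝ) : ℂ)) * fhatN s N ξ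

/-- `∂ₓ^γ(|U|² U)` at time `t`, where `U = e^{it∂ₓ⁴} f_N`. -/
noncomputable def cubicGN (s N : ℝ) (γ : ℕ) (t : ℝ) : ℝ → ℂ :=
  iteratedDeriv γ fun y : ℝ =>
    freeUN s N t y * (starRingEnd ℂ) (freeUN s N t y) * freeUN s N t y

/-- The Duhamel term
`∫₀ᵗ e^{i(t-t')∂ₓ⁴} ∂ₓ^γ(|e^{it'∂ₓ⁴}f_N|² e^{it'∂ₓ⁴}f_N) dt'`. -/
noncomputable def duhamelCubicN (s N : ℝ) (γ : ℕ) (t x : ℝ) : ℂ :=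
  ∫ t' in (0 : ℝ)..t,
    ((Real.sqrt (2 * Real.pi) : ℝ) : ℂ)⁻¹ *
      ∫ ξ : ℝ, Complex.exp (Complex.I * ((x * ξ + (t - t') * ξ ^ 4 : ℝ) : ℂ)) *
        paperFT (cubicGN s N γ t') ξ

/-- The inhomogeneous Sobolev `H^s` norm, `‖g‖_{H^s} = ‖⟨ξ⟩^s ĝ‖_{L²}`. -/
noncomputable def sobolevHsNorm (s : ℝ) (g : ℝ → ℂ) : ℝ≥0∞ :=
  eLpNorm (fun ξ : ℝ => ((1 + |ξ|) ^ s : ℝ) • paperFT g ξ) 2 volume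


open Set

/-- Integration by parts bound for a one-dimensional oscillatory integral. -/
theorem norm_mul_integral_exp_mul_le {l r M : ℝ} (hlr : l ≤ r) {f : ℝ → ℂ} (hf : ContDiff ℝ 1 f)
    (hM : ∀ a ∈ Icc l r, ‖f a‖ ≤ M) (hM' : ∀ a ∈ Icc l r, ‖deriv f a‖ ≤ M) (x : ℝ) :
    |x| * ‖∫ a in Icc l r, Complex.exp (Complex.I * ((x * a : ℝ) : ℂ)) * f a‖
      ≤ (2 + (r - l)) * M := by
  have hder : ∀ a : ℝ, HasDerivAt (fun a : ℝ => Complex.exp (Complex.I * ((x * a : ℝ) : ℂ)))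
      (Complex.I * x * Complex.exp (Complex.I * ((x * a : ℝ) : ℂ))) a := by
    intro a
    have h1 : HasDerivAt (fun a : ℝ => ((x * a : ℝ) : ℂ)) (x : ℂ) a := by
      simpa using ((hasDerivAt_id a).const_mul x).ofReal_comp
    convert (h1.const_mul Complex.I).cexp using 1
    ring
  have hn : ∀ a : ℝ, ‖Complex.exp (Complex.I * ((x * a : ℝ) : ℂ))‖ = 1 := fun a => by
    rw [mul_comm, Complex.norm_exp_ofReal_mul_I]
  have hd : Continuous (deriv f) := hf.continuous_deriv le_rfl
  have ibp := intervalIntegral.integral_mul_deriv_eq_deriv_mul (a := l) (b := r)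
    (u := f) (u' := deriv f) (v := fun a : ℝ => Complex.exp (Complex.I * ((x * a : ℝ) : ℂ)))
    (v' := fun a : ℝ => Complex.I * x * Complex.exp (Complex.I * ((x * a : ℝ) : ℂ)))
    (fun a _ => (hf.differentiable one_ne_zero a).hasDerivAt) (fun a _ => hder a)
    (hd.intervalIntegrable _ _) (Continuous.intervalIntegrable (by fun_prop) _ _)
  have e1 : |x| * ‖∫ a in Icc l r, Complex.exp (Complex.I * ((x * a : ℝ) : ℂ)) * f a‖
      = ‖∫ a in l..r, f a * (Complex.I * x * Complex.exp (Complex.I * ((x * a : ℝ) : ℂ)))‖ := by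
    rw [integral_Icc_eq_integral_Ioc, ← intervalIntegral.integral_of_le hlr,
      ← Real.norm_eq_abs, ← Complex.norm_real x]
    rw [← one_mul ‖(x : ℂ)‖, ← Complex.norm_I, ← norm_mul, ← norm_mul,
      ← intervalIntegral.integral_const_mul]
    congr 2; ext a; ring
  have e2 : ‖∫ a in l..r, deriv f a * Complex.exp (Complex.I * ((x * a : ℝ) : ℂ))‖
      ≤ M * (r - l) := by
    have := intervalIntegral.norm_integral_le_of_norm_le_const (a := l) (b := r) (C := M)
      (f := fun a => deriv f a * Complex.exp (Complex.I * ((x * a : ℝ) : ℂ))) ?_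
    · rwa [abs_of_nonneg (by linarith)] at this
    · intro a ha
      rw [uIoc_of_le hlr] at ha
      rw [norm_mul, hn, mul_one]
      exact hM' a ⟨ha.1.le, ha.2⟩
  rw [e1, ibp]
  have e3 := hM l ⟨le_rfl, hlr⟩
  have e4 := hM r ⟨hlr, le_rfl⟩
  calc _ ≤ _ := norm_sub_le _ _
    _ ≤ (‖f r‖ + ‖f l‖) + M * (r - l) := by
      gcongr
      refine (norm_sub_le _ _).trans ?_
      rw [norm_mul, norm_mul, hn, hn]; simp
    _ ≤ _ := by linarith

/-- A continuous function on the plane is integrable on a rectangle. -/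
theorem Continuous.integrable_prod_restrict_Icc {f : ℝ × ℝ → ℂ} (hf : Continuous f)
    (l r l' r' : ℝ) :
    Integrable f ((volume.restrict (Icc l r)).prod (volume.restrict (Icc l' r'))) := by
  rw [Measure.prod_restrict]
  exact hf.continuousOn.integrableOn_compact (isCompact_Icc.prod isCompact_Icc)

/-- Double integration by parts bound for a two-dimensional oscillatory integral. -/
theorem sq_mul_norm_integral_integral_exp_mul_le {l r M : ℝ} (hlr : l ≤ r) {f f' : ℝ → ℝ → ℂ}
    (hder : ∀ a c, HasDerivAt (fun a => f a c) (f' a c) a)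
    (hf : ContDiff ℝ 1 (Function.uncurry f)) (hf' : ContDiff ℝ 1 (Function.uncurry f'))
    (h00 : ∀ a ∈ Icc l r, ∀ c ∈ Icc l r, ‖f a c‖ ≤ M)
    (h10 : ∀ a ∈ Icc l r, ∀ c ∈ Icc l r, ‖f' a c‖ ≤ M)
    (h01 : ∀ a ∈ Icc l r, ∀ c ∈ Icc l r, ‖deriv (f a) c‖ ≤ M)
    (h11 : ∀ a ∈ Icc l r, ∀ c ∈ Icc l r, ‖deriv (f' a) c‖ ≤ M) (x : ℝ) :
    x ^ 2 * ‖∫ c in Icc l r, ∫ a in Icc l r,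
      Complex.exp (Complex.I * ((x * (a + c) : ℝ) : ℂ)) * f a c‖ ≤ (2 + (r - l)) ^ 2 * M := by
  set e : ℝ → ℂ := fun a => Complex.exp (Complex.I * ((x * a : ℝ) : ℂ)) with he
  have hexp : ∀ a c, Complex.exp (Complex.I * ((x * (a + c) : ℝ) : ℂ)) = e c * e a := by
    intro a c
    rw [he, ← Complex.exp_add]; congr 1; push_cast; ring
  have hec : Continuous e := by rw [he]; fun_prop
  have hev : Continuous fun a => Complex.I * x * e a := by fun_prop
  have hn : ∀ a : ℝ, ‖e a‖ = 1 := fun a => by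
    rw [he]; simp only; rw [mul_comm, Complex.norm_exp_ofReal_mul_I]
  have hed : ∀ a : ℝ, HasDerivAt e (Complex.I * x * e a) a := by
    intro a
    have h1 : HasDerivAt (fun a : ℝ => ((x * a : ℝ) : ℂ)) (x : ℂ) a := by
      simpa using ((hasDerivAt_id a).const_mul x).ofReal_comp
    convert (h1.const_mul Complex.I).cexp using 1
    rw [he]; ring
  have hfa : ∀ a, ContDiff ℝ 1 (f a) := fun a => hf.comp (contDiff_const.prodMk contDiff_id)
  have hfa' : ∀ a, ContDiff ℝ 1 (f' a) := fun a => hf'.comp (contDiff_const.prodMk contDiff_id)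
  have hfc : ∀ c, Continuous fun a => f a c := fun c => hf.continuous.comp (continuous_id.prodMk continuous_const)
  have hfc' : ∀ c, Continuous fun a => f' a c := fun c => hf'.continuous.comp (continuous_id.prodMk continuous_const)
  have hfj : Continuous fun p : ℝ × ℝ => f p.1 p.2 := hf.continuous
  have hfj' : Continuous fun p : ℝ × ℝ => f' p.1 p.2 := hf'.continuous
  have inner : ∀ c, Complex.I * x * ∫ a in Icc l r, e a * f a c
      = e r * f r c - e l * f l c - ∫ a in Icc l r, e a * f' a c := by
    intro c
    have ibp := intervalIntegral.integral_mul_deriv_eq_deriv_mul (a := l) (b := r)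
      (u := fun a => f a c) (u' := fun a => f' a c) (v := e) (v' := fun a => Complex.I * x * e a)
      (fun a _ => hder a c) (fun a _ => hed a)
      ((hfc' c).intervalIntegrable _ _) (hev.intervalIntegrable _ _)
    rw [integral_Icc_eq_integral_Ioc, integral_Icc_eq_integral_Ioc,
      ← intervalIntegral.integral_of_le hlr, ← intervalIntegral.integral_of_le hlr,
      ← intervalIntegral.integral_const_mul]
    calc _ = ∫ a in l..r, f a c * (Complex.I * x * e a) := by congr 1; ext a; ring
      _ = _ := by
        rw [ibp, mul_comm (e r), mul_comm (e l)]; congr 2; ext a; ring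
  have key : Complex.I * x * (∫ c in Icc l r, ∫ a in Icc l r,
      Complex.exp (Complex.I * ((x * (a + c) : ℝ) : ℂ)) * f a c)
      = e r * (∫ c in Icc l r, e c * f r c) - e l * (∫ c in Icc l r, e c * f l c)
        - ∫ a in Icc l r, e a * ∫ c in Icc l r, e c * f' a c := by
    have hi : ∀ g : ℝ → ℂ, Continuous g → Integrable g (volume.restrict (Icc l r)) :=
      fun g hg => hg.continuousOn.integrableOn_compact isCompact_Icc
    have hswap : ∫ a in Icc l r, e a * ∫ c in Icc l r, e c * f' a c
        = ∫ c in Icc l r, ∫ a in Icc l r, e c * (e a * f' a c) := by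
      rw [integral_integral_swap]
      · congr 1; ext a; rw [← integral_const_mul]; congr 1; ext c; ring
      · exact Continuous.integrable_prod_restrict_Icc
          (f := fun p : ℝ × ℝ => e p.1 * (e p.2 * f' p.2 p.1)) (by fun_prop) _ _ _ _
    rw [hswap, ← integral_const_mul, ← integral_const_mul, ← integral_const_mul,
      ← integral_sub, ← integral_sub]
    · congr 1; ext c
      simp only [hexp, mul_assoc, integral_const_mul]
      have := inner c
      linear_combination e c * this
    · refine hi _ ?_
      have := (hfa r).continuous; have := (hfa l).continuous
      fun_prop
    · exact (Continuous.integrable_prod_restrict_Icc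
          (f := fun p : ℝ × ℝ => e p.1 * (e p.2 * f' p.2 p.1))
          (by fun_prop) l r l r).integral_prod_left
    · refine hi _ ?_
      have := (hfa r).continuous
      fun_prop
    · refine hi _ ?_
      have := (hfa l).continuous
      fun_prop
  have hM : 0 ≤ M := (norm_nonneg _).trans (h00 l ⟨le_rfl, hlr⟩ l ⟨le_rfl, hlr⟩)
  have b1 : ∀ a ∈ Icc l r, |x| * ‖∫ c in Icc l r, e c * f a c‖ ≤ (2 + (r - l)) * M := fun a ha =>
    norm_mul_integral_exp_mul_le hlr (hfa a) (h00 a ha) (h01 a ha) x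
  have b2 : ∀ a ∈ Icc l r, |x| * ‖∫ c in Icc l r, e c * f' a c‖ ≤ (2 + (r - l)) * M := fun a ha =>
    norm_mul_integral_exp_mul_le hlr (hfa' a) (h10 a ha) (h11 a ha) x
  have b3 : |x| * ‖∫ a in Icc l r, e a * ∫ c in Icc l r, e c * f' a c‖
      ≤ (2 + (r - l)) * M * (r - l) := by
    rw [← Real.norm_eq_abs, ← Complex.norm_real x, ← norm_mul, ← integral_const_mul]
    have := norm_setIntegral_le_of_norm_le_const (μ := volume) (s := Icc l r)
      (f := fun a => (x : ℂ) * (e a * ∫ c in Icc l r, e c * f' a c))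
      (C := (2 + (r - l)) * M) (by simp) ?_
    · simpa [Measure.real, hlr] using this
    · intro a ha
      rw [norm_mul, norm_mul, hn, one_mul, Complex.norm_real, Real.norm_eq_abs]
      exact b2 a ha
  have hx : x ^ 2 * ‖∫ c in Icc l r, ∫ a in Icc l r,
      Complex.exp (Complex.I * ((x * (a + c) : ℝ) : ℂ)) * f a c‖ = |x| * ‖Complex.I * x *
        (∫ c in Icc l r, ∫ a in Icc l r,
          Complex.exp (Complex.I * ((x * (a + c) : ℝ) : ℂ)) * f a c)‖ := by
    rw [norm_mul, norm_mul, Complex.norm_I, Complex.norm_real, Real.norm_eq_abs, ← sq_abs]; ring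
  rw [hx, key]
  calc _ ≤ |x| * (‖∫ c in Icc l r, e c * f r c‖ + ‖∫ c in Icc l r, e c * f l c‖
        + ‖∫ a in Icc l r, e a * ∫ c in Icc l r, e c * f' a c‖) := by
        gcongr
        refine (norm_sub_le _ _).trans ?_
        gcongr
        refine (norm_sub_le _ _).trans ?_
        rw [norm_mul, norm_mul, hn, hn, one_mul, one_mul]
    _ ≤ _ := by
      have h1 := b1 r ⟨hlr, le_rfl⟩
      have h2 := b1 l ⟨le_rfl, hlr⟩
      nlinarith

/-- The trilinear oscillatory integral `∫∫∫ e^{ix(a-b+c)} Ψ(a,b,c)` over the cube `[l,r]³`. -/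
noncomputable def oscInt (l r : ℝ) (Ψ : ℝ × ℝ × ℝ → ℂ) (x : ℝ) : ℂ :=
  ∫ p, (∫ a in Icc l r, Complex.exp (Complex.I * ((x * (a - p.1 + p.2) : ℝ) : ℂ)) * Ψ (a, p))
    ∂((volume.restrict (Icc l r)).prod (volume.restrict (Icc l r)))

/-- The integral of `Ψ` over the slice `a - b + c = ξ` of the cube `[l,r]³`. -/
noncomputable def sliceDensity (l r : ℝ) (Ψ : ℝ × ℝ × ℝ → ℂ) (ξ : ℝ) : ℂ :=
  ∫ p, (Icc l r).indicator (fun a => Ψ (a, p)) (ξ + p.1 - p.2)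
    ∂((volume.restrict (Icc l r)).prod (volume.restrict (Icc l r)))

/-- A continuous function is integrable on a cube. -/
theorem Continuous.integrable_prod_prod_restrict_Icc {f : (ℝ × ℝ) × ℝ → ℂ} (hf : Continuous f)
    (l r : ℝ) :
    Integrable f (((volume.restrict (Icc l r)).prod (volume.restrict (Icc l r))).prod
      (volume.restrict (Icc l r))) := by
  rw [Measure.prod_restrict, Measure.prod_restrict]
  exact hf.continuousOn.integrableOn_compact ((isCompact_Icc.prod isCompact_Icc).prod isCompact_Icc)

theorem oscInt_eq_integral_prod (l r : ℝ) {Ψ : ℝ × ℝ × ℝ → ℂ} (hΨ : Continuous Ψ) (x : ℝ) :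
    oscInt l r Ψ x = ∫ q : (ℝ × ℝ) × ℝ,
      Complex.exp (Complex.I * ((x * (q.2 - q.1.1 + q.1.2) : ℝ) : ℂ)) * Ψ (q.2, q.1)
        ∂(((volume.restrict (Icc l r)).prod (volume.restrict (Icc l r))).prod
          (volume.restrict (Icc l r))) := by
  rw [oscInt, integral_prod _ (Continuous.integrable_prod_prod_restrict_Icc (by fun_prop) l r)]

theorem oscInt_eq_iterated (l r : ℝ) {Ψ : ℝ × ℝ × ℝ → ℂ} (hΨ : Continuous Ψ) (x : ℝ) :
    oscInt l r Ψ x = ∫ b in Icc l r, Complex.exp (Complex.I * ((x * (-b) : ℝ) : ℂ)) *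
      ∫ c in Icc l r, ∫ a in Icc l r,
        Complex.exp (Complex.I * ((x * (a + c) : ℝ) : ℂ)) * Ψ (a, b, c) := by
  have hint : Integrable (fun p : ℝ × ℝ => ∫ a in Icc l r,
      Complex.exp (Complex.I * ((x * (a - p.1 + p.2) : ℝ) : ℂ)) * Ψ (a, p))
      ((volume.restrict (Icc l r)).prod (volume.restrict (Icc l r))) :=
    (Continuous.integrable_prod_prod_restrict_Icc
      (f := fun q => Complex.exp (Complex.I * ((x * (q.2 - q.1.1 + q.1.2) : ℝ) : ℂ)) * Ψ (q.2, q.1))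
      (by fun_prop) l r).integral_prod_left
  rw [oscInt, integral_prod _ hint]
  congr 1; ext b
  rw [← integral_const_mul]
  congr 1; ext c
  rw [← integral_const_mul]
  congr 1; ext a
  rw [← mul_assoc, ← Complex.exp_add]
  congr 2; push_cast; ring

theorem exists_norm_oscInt_le (l r : ℝ) (hlr : l ≤ r) {Ψ : ℝ × ℝ × ℝ → ℂ} (hΨ : ContDiff ℝ 2 Ψ) :
    ∃ C : ℝ, ∀ x, ‖oscInt l r Ψ x‖ ≤ C * (1 + x ^ 2)⁻¹ := by
  set Ψ₁ : ℝ × ℝ × ℝ → ℂ := fun q => fderiv ℝ Ψ q (1, 0, 0) with hΨ₁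
  have c1 : ContDiff ℝ 1 Ψ := hΨ.of_le (by norm_num)
  have c1' : ContDiff ℝ 1 Ψ₁ := (hΨ.fderiv_right (m := 1) (by norm_num)).clm_apply contDiff_const
  have cd : ∀ f : ℝ × ℝ × ℝ → ℂ, ContDiff ℝ 1 f →
      Continuous fun q => fderiv ℝ f q (0, 0, 1) := fun f hf =>
    (hf.continuous_fderiv one_ne_zero).clm_apply continuous_const
  have hc3 : ∀ f : ℝ × ℝ × ℝ → ℂ, ContDiff ℝ 1 f → ∀ a b c,
      deriv (fun c => f (a, b, c)) c = fderiv ℝ f (a, b, c) (0, 0, 1) := fun f hf a b c => by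
    have h : HasDerivAt (fun c : ℝ => (a, b, c)) ((0 : ℝ), (0 : ℝ), (1 : ℝ)) c :=
      (hasDerivAt_const c a).prodMk ((hasDerivAt_const c b).prodMk (hasDerivAt_id c))
    exact ((hf.differentiable one_ne_zero _).hasFDerivAt.comp_hasDerivAt c h).deriv
  have hc1 : ∀ a b c, HasDerivAt (fun a => Ψ (a, b, c)) (Ψ₁ (a, b, c)) a := fun a b c => by
    have h : HasDerivAt (fun a : ℝ => (a, b, c)) ((1 : ℝ), (0 : ℝ), (0 : ℝ)) a :=
      (hasDerivAt_id a).prodMk ((hasDerivAt_const a b).prodMk (hasDerivAt_const a c))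
    exact (c1.differentiable one_ne_zero _).hasFDerivAt.comp_hasDerivAt a h
  have bd : ∀ f : ℝ × ℝ × ℝ → ℂ, Continuous f → ∃ M, ∀ a ∈ Icc l r, ∀ b ∈ Icc l r,
      ∀ c ∈ Icc l r, ‖f (a, b, c)‖ ≤ M := fun f hf => by
    obtain ⟨M, hM⟩ := (isCompact_Icc.prod (isCompact_Icc.prod isCompact_Icc)
      : IsCompact (Icc l r ×ˢ (Icc l r ×ˢ Icc l r))).exists_bound_of_continuousOn hf.continuousOn
    exact ⟨M, fun a ha b hb c hc => hM _ ⟨ha, hb, hc⟩⟩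
  obtain ⟨M1, h1⟩ := bd Ψ c1.continuous
  obtain ⟨M2, h2⟩ := bd Ψ₁ c1'.continuous
  obtain ⟨M3, h3⟩ := bd _ (cd Ψ c1)
  obtain ⟨M4, h4⟩ := bd _ (cd Ψ₁ c1')
  set M := max (max M1 M2) (max M3 M4)
  refine ⟨((2 + (r - l)) ^ 2 * M + M * (r - l) * (r - l)) * (r - l), fun x => ?_⟩
  rw [← div_eq_mul_inv, le_div_iff₀ (by positivity), oscInt_eq_iterated l r c1.continuous]
  have hb : ∀ b ∈ Icc l r, (1 + x ^ 2) * ‖∫ c in Icc l r, ∫ a in Icc l r,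
        Complex.exp (Complex.I * ((x * (a + c) : ℝ) : ℂ)) * Ψ (a, b, c)‖
        ≤ (2 + (r - l)) ^ 2 * M + M * (r - l) * (r - l) := by
    intro b hb
    have k1 := sq_mul_norm_integral_integral_exp_mul_le (M := M) hlr
      (f := fun a c => Ψ (a, b, c)) (f' := fun a c => Ψ₁ (a, b, c)) (fun a c => hc1 a b c)
      (c1.comp (by fun_prop : ContDiff ℝ 1 fun q : ℝ × ℝ => (q.1, b, q.2)))
      (c1'.comp (by fun_prop : ContDiff ℝ 1 fun q : ℝ × ℝ => (q.1, b, q.2)))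
      (fun a ha c hc => (h1 a ha b hb c hc).trans (by simp [M]))
      (fun a ha c hc => (h2 a ha b hb c hc).trans (by simp [M]))
      (fun a ha c hc => by
        rw [hc3 Ψ c1]; exact (h3 a ha b hb c hc).trans (by simp [M]))
      (fun a ha c hc => by
        rw [hc3 Ψ₁ c1']; exact (h4 a ha b hb c hc).trans (by simp [M])) x
    have k2 : ‖∫ c in Icc l r, ∫ a in Icc l r,
        Complex.exp (Complex.I * ((x * (a + c) : ℝ) : ℂ)) * Ψ (a, b, c)‖
        ≤ M * (r - l) * (r - l) := by
      have := norm_setIntegral_le_of_norm_le_const (μ := volume) (s := Icc l r)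
        (f := fun c => ∫ a in Icc l r,
          Complex.exp (Complex.I * ((x * (a + c) : ℝ) : ℂ)) * Ψ (a, b, c))
        (C := M * (r - l)) (by simp) ?_
      · simpa [Measure.real, hlr] using this
      · intro c hc
        have := norm_setIntegral_le_of_norm_le_const (μ := volume) (s := Icc l r)
          (f := fun a => Complex.exp (Complex.I * ((x * (a + c) : ℝ) : ℂ)) * Ψ (a, b, c))
          (C := M) (by simp) ?_
        · simpa [Measure.real, hlr] using this
        · intro a ha
          rw [norm_mul, mul_comm Complex.I, Complex.norm_exp_ofReal_mul_I, one_mul]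
          exact (h1 a ha b hb c hc).trans (by simp [M])
    linarith
  rw [mul_comm, ← abs_of_nonneg (by positivity : 0 ≤ 1 + x ^ 2), ← Real.norm_eq_abs,
    ← Complex.norm_real, ← norm_mul, ← integral_const_mul]
  have := norm_setIntegral_le_of_norm_le_const (μ := volume) (s := Icc l r)
    (f := fun b => (((1 + x ^ 2 : ℝ) : ℂ)) * (Complex.exp (Complex.I * ((x * (-b) : ℝ) : ℂ)) *
      ∫ c in Icc l r, ∫ a in Icc l r,
        Complex.exp (Complex.I * ((x * (a + c) : ℝ) : ℂ)) * Ψ (a, b, c)))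
    (C := (2 + (r - l)) ^ 2 * M + M * (r - l) * (r - l)) (by simp) ?_
  · simpa [Measure.real, hlr] using this
  · intro b hbI
    rw [norm_mul, norm_mul, mul_comm Complex.I, Complex.norm_exp_ofReal_mul_I, one_mul,
      Complex.norm_real, Real.norm_eq_abs, abs_of_nonneg (by positivity)]
    exact hb b hbI

theorem hasDerivAt_oscInt (l r : ℝ) {Ψ : ℝ × ℝ × ℝ → ℂ} (hΨ : Continuous Ψ) (x : ℝ) :
    HasDerivAt (oscInt l r Ψ)
      (oscInt l r (fun q => Complex.I * ((q.1 - q.2.1 + q.2.2 : ℝ) : ℂ) * Ψ q) x) x := by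
  have hi : ∀ {f : (ℝ × ℝ) × ℝ → ℂ}, Continuous f → _ :=
    fun {f} hf => Continuous.integrable_prod_prod_restrict_Icc hf l r
  rw [oscInt_eq_integral_prod l r (by fun_prop)]
  refine HasDerivAt.congr_of_eventuallyEq ?_ (Filter.Eventually.of_forall (oscInt_eq_integral_prod l r hΨ))
  refine (hasDerivAt_integral_of_dominated_loc_of_deriv_le (s := univ)
    (F := fun (y : ℝ) (q : (ℝ × ℝ) × ℝ) =>
      Complex.exp (Complex.I * ((y * (q.2 - q.1.1 + q.1.2) : ℝ) : ℂ)) * Ψ (q.2, q.1))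
    (F' := fun (y : ℝ) (q : (ℝ × ℝ) × ℝ) =>
      Complex.exp (Complex.I * ((y * (q.2 - q.1.1 + q.1.2) : ℝ) : ℂ)) *
        (Complex.I * ((q.2 - q.1.1 + q.1.2 : ℝ) : ℂ) * Ψ (q.2, q.1)))
    (bound := fun q => ‖((q.2 - q.1.1 + q.1.2 : ℝ) : ℂ) * Ψ (q.2, q.1)‖) Filter.univ_mem
    (Filter.Eventually.of_forall fun y => (hi (by fun_prop)).aestronglyMeasurable)
    (hi (by fun_prop)) (hi (by fun_prop)).aestronglyMeasurable
    (Filter.Eventually.of_forall fun q y _ => ?_) (hi (by fun_prop)).norm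
    (Filter.Eventually.of_forall fun q y _ => ?_)).2
  · rw [norm_mul, mul_comm Complex.I, Complex.norm_exp_ofReal_mul_I, one_mul, mul_assoc, norm_mul,
      Complex.norm_I, one_mul]
  · have h1 : HasDerivAt (fun y : ℝ => ((y * (q.2 - q.1.1 + q.1.2) : ℝ) : ℂ))
        ((q.2 - q.1.1 + q.1.2 : ℝ) : ℂ) y := by
      have := ((hasDerivAt_id y).mul_const (q.2 - q.1.1 + q.1.2)).ofReal_comp
      rw [one_mul] at this
      exact this
    have h2 := ((h1.const_mul Complex.I).cexp).mul_const (Ψ (q.2, q.1))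
    rw [mul_assoc (Complex.exp _)] at h2
    exact h2

theorem iteratedDeriv_oscInt (l r : ℝ) {Ψ : ℝ × ℝ × ℝ → ℂ} (hΨ : Continuous Ψ) (n : ℕ) :
    iteratedDeriv n (oscInt l r Ψ)
      = oscInt l r (fun q => (Complex.I * ((q.1 - q.2.1 + q.2.2 : ℝ) : ℂ)) ^ n * Ψ q) := by
  induction n with
  | zero => simp
  | succ n ih =>
    rw [iteratedDeriv_succ, ih]
    ext x
    rw [(hasDerivAt_oscInt l r (by fun_prop) x).deriv]
    congr 1; ext q; ring

theorem integrable_oscInt (l r : ℝ) (hlr : l ≤ r) {Ψ : ℝ × ℝ × ℝ → ℂ} (hΨ : ContDiff ℝ 2 Ψ) :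
    Integrable (oscInt l r Ψ) := by
  obtain ⟨C, hC⟩ := exists_norm_oscInt_le l r hlr hΨ
  refine (integrable_inv_one_add_sq.const_mul C).mono' ?_ (Filter.Eventually.of_forall hC)
  exact Continuous.aestronglyMeasurable (continuous_iff_continuousAt.2 fun x =>
    (hasDerivAt_oscInt l r hΨ.continuous x).continuousAt)

theorem integrable_slice (l r : ℝ) {Ψ : ℝ × ℝ × ℝ → ℂ} (hΨ : Continuous Ψ) :
    Integrable (fun q : (ℝ × ℝ) × ℝ =>
      (Icc l r).indicator (fun a => Ψ (a, q.1)) (q.2 + q.1.1 - q.1.2))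
      (((volume.restrict (Icc l r)).prod (volume.restrict (Icc l r))).prod volume) := by
  have hm : Measurable fun q : (ℝ × ℝ) × ℝ =>
      (Icc l r).indicator (fun a => Ψ (a, q.1)) (q.2 + q.1.1 - q.1.2) := by
    have : (fun q : (ℝ × ℝ) × ℝ =>
        (Icc l r).indicator (fun a => Ψ (a, q.1)) (q.2 + q.1.1 - q.1.2))
        = ((fun q : (ℝ × ℝ) × ℝ => q.2 + q.1.1 - q.1.2) ⁻¹' (Icc l r)).indicator
          (fun q => Ψ (q.2 + q.1.1 - q.1.2, q.1)) := by
      rfl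
    rw [this]
    exact (Continuous.measurable (by fun_prop)).indicator
      ((Continuous.measurable (by fun_prop)) measurableSet_Icc)
  have shift : ∀ (p : ℝ × ℝ) (ξ : ℝ), ξ + p.1 - p.2 = ξ + (p.1 - p.2) := fun p ξ => by ring
  have hn : ∀ p : ℝ × ℝ, ∫ ξ : ℝ, ‖(Icc l r).indicator (fun a => Ψ (a, p)) (ξ + p.1 - p.2)‖
      = ∫ a in Icc l r, ‖Ψ (a, p)‖ := fun p => by
    simp_rw [shift]
    rw [integral_add_right_eq_self
      (fun ξ : ℝ => ‖(Icc l r).indicator (fun a => Ψ (a, p)) ξ‖) (p.1 - p.2),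
      ← integral_indicator measurableSet_Icc]
    simp_rw [norm_indicator_eq_indicator_norm]
  rw [integrable_prod_iff hm.aestronglyMeasurable]
  refine ⟨Filter.Eventually.of_forall fun p => ?_, ?_⟩
  · simp_rw [shift]
    refine Integrable.comp_add_right (f := (Icc l r).indicator fun a => Ψ (a, p)) ?_ _
    rw [integrable_indicator_iff measurableSet_Icc]
    exact (Continuous.continuousOn (by fun_prop)).integrableOn_compact isCompact_Icc
  · simp_rw [hn]
    exact (Continuous.integrable_prod_prod_restrict_Icc
      (f := fun q => Ψ (q.2, q.1)) (by fun_prop) l r).norm.integral_prod_left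

theorem integrable_sliceDensity (l r : ℝ) {Ψ : ℝ × ℝ × ℝ → ℂ} (hΨ : Continuous Ψ) :
    Integrable (sliceDensity l r Ψ) :=
  (integrable_slice l r hΨ).integral_prod_right

theorem oscInt_eq_integral_sliceDensity (l r : ℝ) {Ψ : ℝ × ℝ × ℝ → ℂ} (hΨ : Continuous Ψ)
    (x : ℝ) : oscInt l r Ψ x
      = ∫ ξ : ℝ, Complex.exp (Complex.I * ((x * ξ : ℝ) : ℂ)) * sliceDensity l r Ψ ξ := by
  have hint : Integrable (fun q : (ℝ × ℝ) × ℝ => Complex.exp (Complex.I * ((x * q.2 : ℝ) : ℂ)) *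
      (Icc l r).indicator (fun a => Ψ (a, q.1)) (q.2 + q.1.1 - q.1.2))
      (((volume.restrict (Icc l r)).prod (volume.restrict (Icc l r))).prod volume) := by
    refine (integrable_slice l r hΨ).bdd_mul (c := 1)
      (Continuous.aestronglyMeasurable (by fun_prop)) (Filter.Eventually.of_forall fun q => ?_)
    rw [mul_comm Complex.I, Complex.norm_exp_ofReal_mul_I]
  simp_rw [sliceDensity, ← integral_const_mul]
  rw [integral_integral_swap (f := fun (ξ : ℝ) (p : ℝ × ℝ) =>
    Complex.exp (Complex.I * ((x * ξ : ℝ) : ℂ)) *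
      (Icc l r).indicator (fun a => Ψ (a, p)) (ξ + p.1 - p.2)) hint.swap, oscInt]
  congr 1; ext p
  have : ∀ ξ : ℝ, Complex.exp (Complex.I * ((x * ξ : ℝ) : ℂ)) *
      (Icc l r).indicator (fun a => Ψ (a, p)) (ξ + p.1 - p.2)
      = (Icc l r).indicator (fun a => Complex.exp (Complex.I * ((x * (a - p.1 + p.2) : ℝ) : ℂ))
        * Ψ (a, p)) (ξ + (p.1 - p.2)) := fun ξ => by
    rw [← add_sub_assoc, indicator_apply, indicator_apply]
    split_ifs
    · congr 5; ring
    · simp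
  simp_rw [this]
  rw [integral_add_right_eq_self (fun ξ : ℝ => (Icc l r).indicator (fun a =>
    Complex.exp (Complex.I * ((x * (a - p.1 + p.2) : ℝ) : ℂ)) * Ψ (a, p)) ξ) (p.1 - p.2),
    integral_indicator measurableSet_Icc]

theorem continuousAt_indicator_Icc {l r a : ℝ} {f : ℝ → ℂ} (hf : Continuous f) (hl : a ≠ l)
    (hr : a ≠ r) : ContinuousAt ((Icc l r).indicator f) a := by
  by_cases h : a ∈ Icc l r
  · have : Icc l r ∈ nhds a :=
      Icc_mem_nhds (lt_of_le_of_ne h.1 (Ne.symm hl)) (lt_of_le_of_ne h.2 hr)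
    refine hf.continuousAt.congr ?_
    filter_upwards [this] with b hb using (indicator_of_mem hb f).symm
  · have : (Icc l r)ᶜ ∈ nhds a := isClosed_Icc.isOpen_compl.mem_nhds h
    refine (continuousAt_const (y := (0 : ℂ))).congr ?_
    filter_upwards [this] with b hb using (indicator_of_notMem hb f).symm

theorem continuous_sliceDensity (l r : ℝ) {Ψ : ℝ × ℝ × ℝ → ℂ} (hΨ : Continuous Ψ) :
    Continuous (sliceDensity l r Ψ) := by
  obtain ⟨M, hM⟩ := (isCompact_Icc.prod (isCompact_Icc.prod isCompact_Icc)
    : IsCompact (Icc l r ×ˢ (Icc l r ×ˢ Icc l r))).exists_bound_of_continuousOn hΨ.continuousOn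
  have hmem : ∀ᵐ p ∂((volume.restrict (Icc l r)).prod (volume.restrict (Icc l r))),
      p ∈ Icc l r ×ˢ Icc l r := by
    rw [Measure.prod_restrict]
    exact ae_restrict_mem (measurableSet_Icc.prod measurableSet_Icc)
  have hne : ∀ k ξ : ℝ, ∀ᵐ p ∂((volume.restrict (Icc l r)).prod (volume.restrict (Icc l r))),
      ξ + p.1 - p.2 ≠ k := by
    intro k ξ
    have hset : MeasurableSet {p : ℝ × ℝ | ξ + p.1 - p.2 = k} :=
      (isClosed_eq (by fun_prop) continuous_const).measurableSet
    rw [ae_iff]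
    simp only [ne_eq, not_not]
    rw [Measure.measure_prod_null hset]
    refine Filter.Eventually.of_forall fun b => ?_
    have : Prod.mk b ⁻¹' {p : ℝ × ℝ | ξ + p.1 - p.2 = k} = {ξ + b - k} := by
      ext c; simp only [mem_preimage, mem_ofPred_eq, mem_singleton_iff]
      constructor <;> intro h <;> linarith
    simp only [this]; simp
  refine continuous_iff_continuousAt.2 fun ξ => ?_
  refine continuousAt_of_dominated (bound := fun _ => |M|)
    (Filter.Eventually.of_forall fun y => ?_) (Filter.Eventually.of_forall fun y => ?_)
    (integrable_const _) ?_
  · have : (fun p : ℝ × ℝ => (Icc l r).indicator (fun a => Ψ (a, p)) (y + p.1 - p.2))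
        = ((fun p : ℝ × ℝ => y + p.1 - p.2) ⁻¹' (Icc l r)).indicator
          (fun p => Ψ (y + p.1 - p.2, p)) := by
      rfl
    rw [this]
    exact ((Continuous.measurable (by fun_prop)).indicator
      ((Continuous.measurable (by fun_prop)) measurableSet_Icc)).aestronglyMeasurable
  · filter_upwards [hmem] with p hp
    rw [indicator_apply]
    split_ifs with h
    · exact (hM (_, p) ⟨h, hp⟩).trans (le_abs_self M)
    · simp
  · filter_upwards [hne l ξ, hne r ξ] with p h1 h2
    exact (continuousAt_indicator_Icc (f := fun a => Ψ (a, p)) (by fun_prop) h1 h2).comp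
      (f := fun y : ℝ => y + p.1 - p.2) (Continuous.continuousAt (by fun_prop))

/-- The Fourier transform of the oscillatory integral recovers the slice density. -/
theorem paperFT_oscInt (l r : ℝ) (hlr : l ≤ r) {Ψ : ℝ × ℝ × ℝ → ℂ} (hΨ : ContDiff ℝ 2 Ψ) (ξ : ℝ) :
    paperFT (oscInt l r Ψ) ξ
      = ((Real.sqrt (2 * Real.pi) : ℝ) : ℂ)⁻¹ * ((2 * Real.pi : ℝ) : ℂ) * sliceDensity l r Ψ ξ := by
  have hpi : (0 : ℝ) < 2 * Real.pi := by positivity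
  have hinv : ∀ y : ℝ, FourierTransformInv.fourierInv (sliceDensity l r Ψ) y
      = oscInt l r Ψ (2 * Real.pi * y) := fun y => by
    rw [Real.fourierInv_eq_fourier_neg, Real.fourier_real_eq_integral_exp_smul,
      oscInt_eq_integral_sliceDensity l r hΨ.continuous]
    congr 1; ext v
    rw [smul_eq_mul]; congr 2; push_cast; ring
  have hfun : FourierTransformInv.fourierInv (sliceDensity l r Ψ)
      = fun y => oscInt l r Ψ (2 * Real.pi * y) := funext hinv
  have hint : Integrable (fun y => oscInt l r Ψ (2 * Real.pi * y)) :=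
    (integrable_oscInt l r hlr hΨ).comp_mul_left' hpi.ne'
  have hint' : Integrable (FourierTransform.fourier (sliceDensity l r Ψ)) := by
    have : FourierTransform.fourier (sliceDensity l r Ψ)
        = fun y => oscInt l r Ψ (2 * Real.pi * (-y)) := by
      ext y; rw [← hinv, Real.fourierInv_eq_fourier_neg, neg_neg]
    rw [this]
    exact hint.comp_neg
  have key := congrFun ((continuous_sliceDensity l r hΨ.continuous).fourier_fourierInv_eq
    (integrable_sliceDensity l r hΨ.continuous) hint') ξ
  rw [← key, hfun, Real.fourier_real_eq_integral_exp_smul, paperFT, mul_assoc]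
  congr 1
  have := Measure.integral_comp_mul_left (fun x : ℝ =>
    Complex.exp (-(Complex.I * ((x * ξ : ℝ) : ℂ))) * oscInt l r Ψ x) (2 * Real.pi)
  rw [abs_of_pos (inv_pos.2 hpi), Complex.real_smul] at this
  calc _ = ((2 * Real.pi : ℝ) : ℂ) * ((((2 * Real.pi)⁻¹ : ℝ) : ℂ) *
      ∫ x : ℝ, Complex.exp (-(Complex.I * ((x * ξ : ℝ) : ℂ))) * oscInt l r Ψ x) := by
        rw [← mul_assoc, ← Complex.ofReal_mul, mul_inv_cancel₀ hpi.ne', Complex.ofReal_one, one_mul]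
    _ = _ := by
        rw [← this]
        congr 2; ext v
        rw [smul_eq_mul]; congr 2; push_cast; ring

theorem intervalIntegral_oscInt (l r x : ℝ) {t : ℝ} (ht : 0 ≤ t) {Φ : ℝ → ℝ × ℝ × ℝ → ℂ}
    (hΦ : Continuous (Function.uncurry Φ)) :
    ∫ t' in (0 : ℝ)..t, oscInt l r (Φ t') x
      = oscInt l r (fun q => ∫ t' in (0 : ℝ)..t, Φ t' q) x := by
  have hΦ' : Continuous fun z : ℝ × ℝ × ℝ × ℝ => Φ z.1 z.2 := hΦ
  rw [oscInt_eq_integral_prod l r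
    (intervalIntegral.continuous_parametric_intervalIntegral_of_continuous'
      (f := fun q t' => Φ t' q) (hΦ.comp continuous_swap) 0 t)]
  have h1 : ∀ t', oscInt l r (Φ t') x = _ := fun t' =>
    oscInt_eq_integral_prod l r (hΦ.comp (Continuous.prodMk_right t')) x
  simp_rw [h1, intervalIntegral.integral_of_le ht, ← integral_const_mul]
  refine integral_integral_swap (f := fun (t' : ℝ) (q : (ℝ × ℝ) × ℝ) =>
    Complex.exp (Complex.I * ((x * (q.2 - q.1.1 + q.1.2) : ℝ) : ℂ)) * Φ t' (q.2, q.1)) ?_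
  rw [Measure.restrict_congr_set Ioc_ae_eq_Icc, Measure.prod_restrict, Measure.prod_restrict,
    Measure.prod_restrict]
  refine Continuous.continuousOn (f := fun z : ℝ × (ℝ × ℝ) × ℝ => Complex.exp
      (Complex.I * ((x * (z.2.2 - z.2.1.1 + z.2.1.2) : ℝ) : ℂ)) * Φ z.1 (z.2.2, z.2.1))
      (by fun_prop) |>.integrableOn_compact
      (isCompact_Icc.prod ((isCompact_Icc.prod isCompact_Icc).prod isCompact_Icc))

theorem mul_sliceDensity (l r : ℝ) (Ψ : ℝ × ℝ × ℝ → ℂ) (m : ℝ → ℂ) (ξ : ℝ) :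
    m ξ * sliceDensity l r Ψ ξ
      = sliceDensity l r (fun q => m (q.1 - q.2.1 + q.2.2) * Ψ q) ξ := by
  rw [sliceDensity, sliceDensity, ← integral_const_mul]
  congr 1; ext p
  rw [indicator_apply, indicator_apply]
  split_ifs
  · congr 2; ring
  · simp

/-- `∫₀ᵗ e^{i t' w} dt'` as a function of `w`. -/
noncomputable def expInt (t w : ℝ) : ℂ :=
  ∫ t' in (0 : ℝ)..t, Complex.exp (Complex.I * ((t' * w : ℝ) : ℂ))

theorem contDiff_expInt {t : ℝ} (ht : 0 ≤ t) : ContDiff ℝ 2 (expInt t) := by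
  have h1 : ContDiff ℝ ((2 : ℕ∞) : WithTop ℕ∞) (FourierTransform.fourier
      ((Icc 0 t).indicator fun _ : ℝ => (1 : ℂ))) := by
    refine Real.contDiff_fourier fun n _ => ?_
    have : (fun v : ℝ => ‖v‖ ^ n * ‖(Icc 0 t).indicator (fun _ : ℝ => (1 : ℂ)) v‖)
        = (Icc 0 t).indicator fun v => ‖v‖ ^ n := by
      ext v; by_cases h : v ∈ Icc 0 t
      · simp only [indicator_of_mem h]; simp
      · simp only [indicator_of_notMem h]; simp
    rw [this, integrable_indicator_iff measurableSet_Icc]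
    exact (Continuous.continuousOn (by fun_prop)).integrableOn_compact isCompact_Icc
  have h2 : expInt t = fun w => FourierTransform.fourier
      ((Icc 0 t).indicator fun _ : ℝ => (1 : ℂ)) ((-(2 * Real.pi)⁻¹) * w) := by
    ext w
    rw [Real.fourier_real_eq_integral_exp_smul, expInt, intervalIntegral.integral_of_le ht,
      ← integral_Icc_eq_integral_Ioc, ← integral_indicator measurableSet_Icc]
    congr 1; ext v
    rw [indicator_apply, indicator_apply]
    split_ifs
    · rw [smul_eq_mul, mul_one]
      congr 1
      have : (Real.pi : ℂ) ≠ 0 := by exact_mod_cast Real.pi_ne_zero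
      push_cast; field_simp
    · simp
  rw [h2]
  exact h1.comp (contDiff_const.mul contDiff_id)

theorem half_mul_le_re_expInt {t w : ℝ} (ht : 0 ≤ t) (hw : t * |w| ≤ 1) :
    t / 2 ≤ (expInt t w).re := by
  have h1 : (expInt t w).re = ∫ t' in (0 : ℝ)..t, Real.cos (t' * w) := by
    rw [expInt, ← Complex.reCLM_apply, ← ContinuousLinearMap.intervalIntegral_comp_comm]
    · congr 1; ext v
      rw [Complex.reCLM_apply, mul_comm, Complex.exp_ofReal_mul_I_re]
    · exact Continuous.intervalIntegrable (by fun_prop) _ _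
  rw [h1]
  have h2 : ∫ _ in (0 : ℝ)..t, (1 / 2 : ℝ) = t / 2 := by simp; ring
  rw [← h2]
  refine intervalIntegral.integral_mono_on ht (by simp)
    (Continuous.intervalIntegrable (by fun_prop) _ _) fun v hv => ?_
  have h3 : |v * w| ≤ 1 := by
    rw [abs_mul, abs_of_nonneg hv.1]
    exact (mul_le_mul_of_nonneg_right hv.2 (abs_nonneg w)).trans hw
  have h4 := Real.one_sub_sq_div_two_le_cos (x := v * w)
  have h5 : (v * w) ^ 2 ≤ 1 := (sq_le_one_iff_abs_le_one _).2 h3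
  linarith

/-- Near the frequency `N` and at scale `N⁻¹` the resonance function is bounded. -/
theorem abs_resonance_le {N a b c : ℝ} (hN : 1 ≤ N) (ha : a ∈ Icc (N - N⁻¹) (N + N⁻¹))
    (hb : b ∈ Icc (N - N⁻¹) (N + N⁻¹)) (hc : c ∈ Icc (N - N⁻¹) (N + N⁻¹)) :
    |a ^ 4 - b ^ 4 + c ^ 4 - (a - b + c) ^ 4| ≤ 1000 := by
  set d := N⁻¹ with hd
  have hd0 : 0 < d := inv_pos.2 (by linarith)
  have hd1 : d ≤ 1 := inv_le_one_of_one_le₀ hN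
  have hNd : N * d = 1 := mul_inv_cancel₀ (by linarith)
  have hfac : a ^ 4 - b ^ 4 + c ^ 4 - (a - b + c) ^ 4
      = -((a - b) * (c - b) * (12 * b ^ 2 + 12 * (b * ((a - b) + (c - b)))
        + (4 * (a - b) ^ 2 + 6 * ((a - b) * (c - b)) + 4 * (c - b) ^ 2))) := by ring
  rw [hfac]
  have hu : |a - b| ≤ 2 * d := by rw [abs_le]; constructor <;> linarith [ha.1, ha.2, hb.1, hb.2]
  have hv : |c - b| ≤ 2 * d := by rw [abs_le]; constructor <;> linarith [hc.1, hc.2, hb.1, hb.2]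
  have hb' : |b| ≤ 2 * N := by rw [abs_le]; constructor <;> linarith [hb.1, hb.2]
  generalize a - b = u at *
  generalize c - b = v at *
  have huv : |u * v| ≤ 4 * d ^ 2 := by
    rw [abs_mul]
    calc _ ≤ (2 * d) * (2 * d) := by gcongr
      _ = _ := by ring
  have hs : |u + v| ≤ 4 * d := (abs_add_le _ _).trans (by linarith)
  have h1 : |12 * b ^ 2| ≤ 48 * N ^ 2 := by
    rw [abs_mul, abs_pow, abs_of_pos (by norm_num : (0 : ℝ) < 12)]
    calc _ ≤ 12 * (2 * N) ^ 2 := by gcongr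
      _ = _ := by ring
  have h2 : |12 * (b * (u + v))| ≤ 96 := by
    rw [abs_mul, abs_mul, abs_of_pos (by norm_num : (0 : ℝ) < 12)]
    calc _ ≤ 12 * ((2 * N) * (4 * d)) := by gcongr
      _ = 96 * (N * d) := by ring
      _ = _ := by rw [hNd, mul_one]
  have h3 : |4 * u ^ 2 + 6 * (u * v) + 4 * v ^ 2| ≤ 56 := by
    have hu2 : u ^ 2 ≤ 4 := by
      rw [← sq_abs]; nlinarith [abs_nonneg u]
    have hv2 : v ^ 2 ≤ 4 := by
      rw [← sq_abs]; nlinarith [abs_nonneg v]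
    rw [abs_le]; constructor <;> nlinarith [sq_nonneg (u + v), sq_nonneg (u - v)]
  have h4 : |12 * b ^ 2 + 12 * (b * (u + v)) + (4 * u ^ 2 + 6 * (u * v) + 4 * v ^ 2)|
      ≤ 200 * N ^ 2 := by
    refine (abs_add_le _ _).trans ?_
    have := abs_add_le (12 * b ^ 2) (12 * (b * (u + v)))
    nlinarith
  rw [abs_neg, abs_mul]
  calc _ ≤ (4 * d ^ 2) * (200 * N ^ 2) := by gcongr
    _ = 800 * (N * d) ^ 2 := by ring
    _ ≤ 1000 := by rw [hNd]; norm_num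

theorem freeUN_eq (s N t x : ℝ) : freeUN s N t x =
    (((Real.sqrt (2 * Real.pi))⁻¹ * N ^ (-s + 1 / 2) : ℝ) : ℂ) *
      ∫ ξ in Icc (N - N⁻¹) (N + N⁻¹), Complex.exp (Complex.I * ((x * ξ + t * ξ ^ 4 : ℝ) : ℂ)) := by
  rw [freeUN, ← integral_indicator measurableSet_Icc]
  rw [Complex.ofReal_mul, Complex.ofReal_inv, mul_assoc]
  congr 1
  rw [← integral_const_mul]
  refine integral_congr_ae (Filter.Eventually.of_forall fun ξ => ?_)
  simp only
  rw [fhatN, indicator_apply, indicator_apply]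
  split_ifs
  · ring
  · simp

theorem freeUN_mul_conj_mul (s N t : ℝ) :
    (fun y => freeUN s N t y * (starRingEnd ℂ) (freeUN s N t y) * freeUN s N t y)
      = oscInt (N - N⁻¹) (N + N⁻¹) (fun q =>
        (((Real.sqrt (2 * Real.pi))⁻¹ * N ^ (-s + 1 / 2) : ℝ) : ℂ) ^ 3 *
          Complex.exp (Complex.I * ((t * (q.1 ^ 4 - q.2.1 ^ 4 + q.2.2 ^ 4) : ℝ) : ℂ))) := by
  ext y
  rw [freeUN_eq]
  set K : ℝ := (Real.sqrt (2 * Real.pi))⁻¹ * N ^ (-s + 1 / 2)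
  set e : ℝ → ℂ := fun ξ => Complex.exp (Complex.I * ((y * ξ + t * ξ ^ 4 : ℝ) : ℂ)) with he
  rw [map_mul, Complex.conj_ofReal, ← integral_conj]
  have h1 : ∀ p : ℝ × ℝ, (∫ a in Icc (N - N⁻¹) (N + N⁻¹),
      Complex.exp (Complex.I * ((y * (a - p.1 + p.2) : ℝ) : ℂ)) * ((K : ℂ) ^ 3 *
          Complex.exp (Complex.I * ((t * (a ^ 4 - p.1 ^ 4 + p.2 ^ 4) : ℝ) : ℂ))))
      = ((K : ℂ) ^ 3 * ∫ a in Icc (N - N⁻¹) (N + N⁻¹), e a) *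
        ((starRingEnd ℂ) (e p.1) * e p.2) := by
    intro p
    rw [← integral_const_mul, ← integral_mul_const]
    congr 1; ext a
    rw [mul_left_comm, mul_assoc ((K : ℂ) ^ 3)]
    congr 1
    rw [he]
    simp only
    rw [← Complex.exp_conj, ← Complex.exp_add, ← Complex.exp_add, ← Complex.exp_add, map_mul,
      Complex.conj_I, Complex.conj_ofReal]
    congr 1; push_cast; ring
  rw [oscInt]
  simp_rw [h1]
  rw [integral_const_mul, integral_prod_mul (fun b => (starRingEnd ℂ) (e b)) e]
  ring

theorem cubicGN_eq (s N : ℝ) (γ : ℕ) (t : ℝ) : cubicGN s N γ t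
    = oscInt (N - N⁻¹) (N + N⁻¹) (fun q =>
      (Complex.I * ((q.1 - q.2.1 + q.2.2 : ℝ) : ℂ)) ^ γ *
        ((((Real.sqrt (2 * Real.pi))⁻¹ * N ^ (-s + 1 / 2) : ℝ) : ℂ) ^ 3 *
          Complex.exp (Complex.I * ((t * (q.1 ^ 4 - q.2.1 ^ 4 + q.2.2 ^ 4) : ℝ) : ℂ)))) := by
  rw [cubicGN, freeUN_mul_conj_mul, iteratedDeriv_oscInt _ _ (by fun_prop)]

theorem inv_sqrt_two_pi_mul :
    ((Real.sqrt (2 * Real.pi) : ℝ) : ℂ)⁻¹ * (((Real.sqrt (2 * Real.pi) : ℝ) : ℂ)⁻¹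
      * ((2 * Real.pi : ℝ) : ℂ)) = 1 := by
  have h : (0 : ℝ) < 2 * Real.pi := by positivity
  have h2 := Real.sq_sqrt h.le
  have h3 := (Real.sqrt_pos.2 h).ne'
  rw [← Complex.ofReal_inv, ← Complex.ofReal_mul, ← Complex.ofReal_mul, ← Complex.ofReal_one]
  congr 1
  field_simp
  linarith

/-- The symbol `(iξ)^γ e^{itξ⁴}` of the Duhamel term, with the amplitude of the data. -/
noncomputable def duhamelSymbol (s N : ℝ) (γ : ℕ) (t ξ : ℝ) : ℂ :=
  (Complex.I * (ξ : ℂ)) ^ γ *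
    ((((Real.sqrt (2 * Real.pi))⁻¹ * N ^ (-s + 1 / 2) : ℝ) : ℂ) ^ 3 *
      Complex.exp (Complex.I * ((t * ξ ^ 4 : ℝ) : ℂ)))

/-- `expInt` evaluated at the resonance function. -/
noncomputable def resonantExpInt (t : ℝ) (q : ℝ × ℝ × ℝ) : ℂ :=
  expInt t (q.1 ^ 4 - q.2.1 ^ 4 + q.2.2 ^ 4 - (q.1 - q.2.1 + q.2.2) ^ 4)

theorem duhamelCubicN_eq (s N : ℝ) (hN : 1 ≤ N) (γ : ℕ) {t : ℝ} (ht : 0 ≤ t) :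
    (fun x => duhamelCubicN s N γ t x) = oscInt (N - N⁻¹) (N + N⁻¹) (fun q =>
      duhamelSymbol s N γ t (q.1 - q.2.1 + q.2.2) * resonantExpInt t q) := by
  have hlr : N - N⁻¹ ≤ N + N⁻¹ := by
    have : 0 < N⁻¹ := inv_pos.2 (by linarith)
    linarith
  ext x
  have hc : ContDiff ℝ 2 fun x : ℝ => (x : ℂ) := Complex.ofRealCLM.contDiff
  have hC : ∀ t' : ℝ, ContDiff ℝ 2 fun q : ℝ × ℝ × ℝ =>
      (Complex.I * ((q.1 - q.2.1 + q.2.2 : ℝ) : ℂ)) ^ γ *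
        ((((Real.sqrt (2 * Real.pi))⁻¹ * N ^ (-s + 1 / 2) : ℝ) : ℂ) ^ 3 *
          Complex.exp (Complex.I * ((t' * (q.1 ^ 4 - q.2.1 ^ 4 + q.2.2 ^ 4) : ℝ) : ℂ))) := by
    intro t'
    have h1 := hc.comp (by fun_prop : ContDiff ℝ 2 fun q : ℝ × ℝ × ℝ => q.1 - q.2.1 + q.2.2)
    have h2 := hc.comp (by fun_prop : ContDiff ℝ 2 fun q : ℝ × ℝ × ℝ =>
      t' * (q.1 ^ 4 - q.2.1 ^ 4 + q.2.2 ^ 4))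
    exact ((contDiff_const.mul h1).pow γ).mul (contDiff_const.mul (contDiff_const.mul h2).cexp)
  have hΦ : ∀ t', ((Real.sqrt (2 * Real.pi) : ℝ) : ℂ)⁻¹ *
      ∫ ξ : ℝ, Complex.exp (Complex.I * ((x * ξ + (t - t') * ξ ^ 4 : ℝ) : ℂ)) *
        paperFT (cubicGN s N γ t') ξ
      = oscInt (N - N⁻¹) (N + N⁻¹) (fun q => duhamelSymbol s N γ t (q.1 - q.2.1 + q.2.2) *
        Complex.exp (Complex.I * ((t' * (q.1 ^ 4 - q.2.1 ^ 4 + q.2.2 ^ 4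
          - (q.1 - q.2.1 + q.2.2) ^ 4) : ℝ) : ℂ))) x := by
    intro t'
    rw [oscInt_eq_integral_sliceDensity _ _ (by unfold duhamelSymbol; fun_prop),
      ← integral_const_mul]
    congr 1; ext ξ
    rw [cubicGN_eq, paperFT_oscInt _ _ hlr (hC t')]
    have hm := mul_sliceDensity (N - N⁻¹) (N + N⁻¹) (fun q : ℝ × ℝ × ℝ =>
      (Complex.I * ((q.1 - q.2.1 + q.2.2 : ℝ) : ℂ)) ^ γ *
        ((((Real.sqrt (2 * Real.pi))⁻¹ * N ^ (-s + 1 / 2) : ℝ) : ℂ) ^ 3 *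
          Complex.exp (Complex.I * ((t' * (q.1 ^ 4 - q.2.1 ^ 4 + q.2.2 ^ 4) : ℝ) : ℂ))))
      (fun ξ => Complex.exp (Complex.I * (((t - t') * ξ ^ 4 : ℝ) : ℂ))) ξ
    have hfun : (fun q : ℝ × ℝ × ℝ => duhamelSymbol s N γ t (q.1 - q.2.1 + q.2.2) *
        Complex.exp (Complex.I * ((t' * (q.1 ^ 4 - q.2.1 ^ 4 + q.2.2 ^ 4
          - (q.1 - q.2.1 + q.2.2) ^ 4) : ℝ) : ℂ)))
        = fun q => Complex.exp (Complex.I * (((t - t') * (q.1 - q.2.1 + q.2.2) ^ 4 : ℝ) : ℂ)) *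
        ((Complex.I * ((q.1 - q.2.1 + q.2.2 : ℝ) : ℂ)) ^ γ *
        ((((Real.sqrt (2 * Real.pi))⁻¹ * N ^ (-s + 1 / 2) : ℝ) : ℂ) ^ 3 *
          Complex.exp (Complex.I * ((t' * (q.1 ^ 4 - q.2.1 ^ 4 + q.2.2 ^ 4) : ℝ) : ℂ)))) := by
      ext q
      rw [duhamelSymbol]
      have : Complex.exp (Complex.I * ((t * (q.1 - q.2.1 + q.2.2) ^ 4 : ℝ) : ℂ)) *
          Complex.exp (Complex.I * ((t' * (q.1 ^ 4 - q.2.1 ^ 4 + q.2.2 ^ 4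
          - (q.1 - q.2.1 + q.2.2) ^ 4) : ℝ) : ℂ))
          = Complex.exp (Complex.I * (((t - t') * (q.1 - q.2.1 + q.2.2) ^ 4 : ℝ) : ℂ)) *
          Complex.exp (Complex.I * ((t' * (q.1 ^ 4 - q.2.1 ^ 4 + q.2.2 ^ 4) : ℝ) : ℂ)) := by
        rw [← Complex.exp_add, ← Complex.exp_add]
        congr 1; push_cast; ring
      linear_combination (Complex.I * ((q.1 - q.2.1 + q.2.2 : ℝ) : ℂ)) ^ γ *
        (((Real.sqrt (2 * Real.pi))⁻¹ * N ^ (-s + 1 / 2) : ℝ) : ℂ) ^ 3 * this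
    rw [hfun, ← hm]
    have hexp : Complex.exp (Complex.I * ((x * ξ + (t - t') * ξ ^ 4 : ℝ) : ℂ))
        = Complex.exp (Complex.I * ((x * ξ : ℝ) : ℂ)) *
          Complex.exp (Complex.I * (((t - t') * ξ ^ 4 : ℝ) : ℂ)) := by
      rw [← Complex.exp_add]; congr 1; push_cast; ring
    rw [hexp]
    have := inv_sqrt_two_pi_mul
    linear_combination (Complex.exp (Complex.I * ((x * ξ : ℝ) : ℂ)) *
          Complex.exp (Complex.I * (((t - t') * ξ ^ 4 : ℝ) : ℂ)) * sliceDensity (N - N⁻¹) (N + N⁻¹)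
            (fun q : ℝ × ℝ × ℝ => (Complex.I * ((q.1 - q.2.1 + q.2.2 : ℝ) : ℂ)) ^ γ *
        ((((Real.sqrt (2 * Real.pi))⁻¹ * N ^ (-s + 1 / 2) : ℝ) : ℂ) ^ 3 *
          Complex.exp (Complex.I * ((t' * (q.1 ^ 4 - q.2.1 ^ 4 + q.2.2 ^ 4) : ℝ) : ℂ)))) ξ) * this
  rw [duhamelCubicN]
  simp_rw [hΦ]
  rw [intervalIntegral_oscInt _ _ _ ht
    (Φ := fun t' q => duhamelSymbol s N γ t (q.1 - q.2.1 + q.2.2) *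
        Complex.exp (Complex.I * ((t' * (q.1 ^ 4 - q.2.1 ^ 4 + q.2.2 ^ 4
          - (q.1 - q.2.1 + q.2.2) ^ 4) : ℝ) : ℂ)))
    (by unfold duhamelSymbol Function.uncurry; fun_prop)]
  congr 1; ext q
  rw [intervalIntegral.integral_const_mul]; rfl

theorem paperFT_duhamelCubicN (s N : ℝ) (hN : 1 ≤ N) (γ : ℕ) {t : ℝ} (ht : 0 ≤ t) (ξ : ℝ) :
    paperFT (fun x => duhamelCubicN s N γ t x) ξ
      = ((Real.sqrt (2 * Real.pi) : ℝ) : ℂ)⁻¹ * ((2 * Real.pi : ℝ) : ℂ) *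
        (duhamelSymbol s N γ t ξ *
          sliceDensity (N - N⁻¹) (N + N⁻¹) (resonantExpInt t) ξ) := by
  have hlr : N - N⁻¹ ≤ N + N⁻¹ := by
    have : 0 < N⁻¹ := inv_pos.2 (by linarith)
    linarith
  have hE : ContDiff ℝ 2 (resonantExpInt t) := (contDiff_expInt ht).comp (by fun_prop)
  have hc : ContDiff ℝ 2 fun x : ℝ => (x : ℂ) := Complex.ofRealCLM.contDiff
  have hS : ContDiff ℝ 2 (duhamelSymbol s N γ t) := by
    unfold duhamelSymbol
    have := hc.comp (by fun_prop : ContDiff ℝ 2 fun ξ : ℝ => t * ξ ^ 4)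
    fun_prop
  have hprod : ContDiff ℝ 2 fun q : ℝ × ℝ × ℝ =>
      duhamelSymbol s N γ t (q.1 - q.2.1 + q.2.2) * resonantExpInt t q :=
    (hS.comp (by fun_prop : ContDiff ℝ 2 fun q : ℝ × ℝ × ℝ => q.1 - q.2.1 + q.2.2)).mul hE
  rw [duhamelCubicN_eq s N hN γ ht, paperFT_oscInt _ _ hlr hprod, mul_sliceDensity]

/-- Lower bound for the slice integral of the resonant time factor near the frequency `N`. -/
theorem le_norm_sliceDensity_resonantExpInt {N ξ : ℝ} (hN : 1 ≤ N)
    (hξ : ξ ∈ Icc N (N + N⁻¹ / 2))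
    (hint : Integrable (fun p : ℝ × ℝ => (Icc (N - N⁻¹) (N + N⁻¹)).indicator
        (fun a => resonantExpInt (1 / 1000) (a, p)) (ξ + p.1 - p.2))
      ((volume.restrict (Icc (N - N⁻¹) (N + N⁻¹))).prod
        (volume.restrict (Icc (N - N⁻¹) (N + N⁻¹))))) :
    (N⁻¹) ^ 2 / 8000 ≤ ‖sliceDensity (N - N⁻¹) (N + N⁻¹) (resonantExpInt (1 / 1000)) ξ‖ := by
  set I := Icc (N - N⁻¹) (N + N⁻¹) with hI
  set g : ℝ × ℝ → ℂ := fun p => I.indicator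
        (fun a => resonantExpInt (1 / 1000) (a, p)) (ξ + p.1 - p.2) with hg
  have hd : 0 < N⁻¹ := inv_pos.2 (by linarith)
  have hre : (sliceDensity (N - N⁻¹) (N + N⁻¹) (resonantExpInt (1 / 1000)) ξ).re
      = ∫ p, (g p).re ∂((volume.restrict I).prod (volume.restrict I)) := by
    rw [sliceDensity, ← Complex.reCLM_apply, ← ContinuousLinearMap.integral_comp_comm _ hint]
    rfl
  have hint' : Integrable (fun p => (g p).re) ((volume.restrict I).prod (volume.restrict I)) :=
    hint.re
  have hpos : ∀ p ∈ I ×ˢ I, ξ + p.1 - p.2 ∈ I → 1 / 2000 ≤ (g p).re := by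
    intro p hp hmem
    simp only [hg]
    rw [indicator_of_mem hmem]
    have hr := abs_resonance_le hN hmem hp.1 hp.2
    have := half_mul_le_re_expInt (t := 1 / 1000) (w := (ξ + p.1 - p.2) ^ 4 - p.1 ^ 4 + p.2 ^ 4
      - (ξ + p.1 - p.2 - p.1 + p.2) ^ 4) (by norm_num) (by linarith)
    rw [resonantExpInt]
    linarith
  have hnn : 0 ≤ᵐ[(volume.restrict I).prod (volume.restrict I)] fun p => (g p).re := by
    rw [Measure.prod_restrict]
    filter_upwards [ae_restrict_mem (measurableSet_Icc.prod measurableSet_Icc)] with p hp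
    by_cases hmem : ξ + p.1 - p.2 ∈ I
    · exact (by norm_num : (0 : ℝ) ≤ 1 / 2000).trans (hpos p hp hmem)
    · simp only [hg]
      rw [indicator_of_notMem hmem]; simp
  set J := Icc (N - N⁻¹ / 4) (N + N⁻¹ / 4) with hJ
  have hJI : J ⊆ I := Icc_subset_Icc (by linarith) (by linarith)
  have hJm : MeasurableSet (J ×ˢ J) := measurableSet_Icc.prod measurableSet_Icc
  have hvol : ((volume.restrict I).prod (volume.restrict I)).real (J ×ˢ J) = (N⁻¹ / 2) ^ 2 := by
    rw [measureReal_def, Measure.prod_prod, Measure.restrict_apply measurableSet_Icc,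
      inter_eq_left.2 hJI, hJ, Real.volume_Icc, ← ENNReal.ofReal_mul (by linarith),
      ENNReal.toReal_ofReal (by nlinarith)]
    ring
  have h1 : 1 / 2000 * ((volume.restrict I).prod (volume.restrict I)).real (J ×ˢ J)
      ≤ ∫ p in J ×ˢ J, (g p).re ∂((volume.restrict I).prod (volume.restrict I)) := by
    refine setIntegral_ge_of_const_le_real hJm (measure_ne_top _ _) (fun p hp => ?_)
      hint'.integrableOn
    refine hpos p ⟨hJI hp.1, hJI hp.2⟩ ⟨?_, ?_⟩
    · linarith [hξ.1, hp.1.1, hp.2.2]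
    · linarith [hξ.2, hp.1.2, hp.2.1]
  have h2 := setIntegral_le_integral (s := J ×ˢ J) hint' hnn
  calc _ = 1 / 2000 * (N⁻¹ / 2) ^ 2 := by ring
    _ ≤ (sliceDensity (N - N⁻¹) (N + N⁻¹) (resonantExpInt (1 / 1000)) ξ).re := by
      rw [hre, ← hvol]; exact h1.trans h2
    _ ≤ _ := Complex.re_le_norm _

theorem mul_rpow_le_one_add_abs_rpow {N ξ : ℝ} (hN : 1 ≤ N) (hξ : ξ ∈ Icc N (N + N⁻¹ / 2))
    (s : ℝ) : (3 : ℝ) ^ (-|s|) * N ^ s ≤ (1 + |ξ|) ^ s := by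
  have hd1 : N⁻¹ ≤ 1 := inv_le_one_of_one_le₀ hN
  have h0 : 0 ≤ ξ := by linarith [hξ.1]
  rw [abs_of_nonneg h0]
  rcases le_total 0 s with hs | hs
  · calc _ ≤ 1 * N ^ s := by
          gcongr
          exact Real.rpow_le_one_of_one_le_of_nonpos (by norm_num) (by simp)
      _ ≤ _ := by
          rw [one_mul]
          exact Real.rpow_le_rpow (by linarith) (by linarith [hξ.1]) hs
  · rw [abs_of_nonpos hs, neg_neg, ← Real.mul_rpow (by norm_num) (by linarith)]
    exact Real.rpow_le_rpow_of_nonpos (by linarith) (by linarith [hξ.2]) hs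

theorem norm_duhamelSymbol (s N : ℝ) (hN : 0 ≤ N) (γ : ℕ) (t ξ : ℝ) :
    ‖duhamelSymbol s N γ t ξ‖
      = |ξ| ^ γ * ((Real.sqrt (2 * Real.pi))⁻¹ * N ^ (-s + 1 / 2)) ^ 3 := by
  rw [duhamelSymbol, norm_mul, norm_mul, norm_pow, norm_pow, norm_mul, Complex.norm_I, one_mul,
    mul_comm Complex.I, Complex.norm_exp_ofReal_mul_I, mul_one, Complex.norm_real,
    Complex.norm_real, Real.norm_eq_abs, Real.norm_eq_abs, abs_of_nonneg (a := _ * _)]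
  positivity

theorem ae_le_norm_rpow_smul_paperFT (s : ℝ) {N : ℝ} (hN : 1 ≤ N) (γ : ℕ) :
    ∀ᵐ ξ : ℝ, ξ ∈ Icc N (N + N⁻¹ / 2) →
      (3 : ℝ) ^ (-|s|) * N ^ s * ((Real.sqrt (2 * Real.pi))⁻¹ * (2 * Real.pi) *
        (N ^ γ * ((Real.sqrt (2 * Real.pi))⁻¹ * N ^ (-s + 1 / 2)) ^ 3 * ((N⁻¹) ^ 2 / 8000)))
      ≤ ‖((1 + |ξ|) ^ s : ℝ) • paperFT (fun x => duhamelCubicN s N γ (1 / 1000) x) ξ‖ := by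
  have hE : Continuous (resonantExpInt (1 / 1000)) :=
    (contDiff_expInt (by norm_num)).continuous.comp (by fun_prop)
  filter_upwards [(integrable_slice (N - N⁻¹) (N + N⁻¹) hE).swap.prod_right_ae] with ξ hint hξ
  have h1 := le_norm_sliceDensity_resonantExpInt hN hξ hint
  have h2 := mul_rpow_le_one_add_abs_rpow hN hξ s
  have hκ : ‖((Real.sqrt (2 * Real.pi) : ℝ) : ℂ)⁻¹ * ((2 * Real.pi : ℝ) : ℂ)‖
      = (Real.sqrt (2 * Real.pi))⁻¹ * (2 * Real.pi) := by
    rw [← Complex.ofReal_inv, ← Complex.ofReal_mul, Complex.norm_real, Real.norm_eq_abs,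
      abs_of_nonneg (by positivity)]
  have hξN : N ≤ |ξ| := hξ.1.trans (le_abs_self ξ)
  rw [paperFT_duhamelCubicN s N hN γ (by norm_num), norm_smul, norm_mul, hκ, norm_mul,
    norm_duhamelSymbol s N (by linarith), Real.norm_eq_abs, abs_of_nonneg (a := (1 + |ξ|) ^ s)
      (by positivity)]
  gcongr

theorem ofReal_mul_le_sobolevHsNorm {s m l r : ℝ} (hm : 0 ≤ m) (hlr : l ≤ r) {g : ℝ → ℂ}
    (h : ∀ᵐ ξ : ℝ, ξ ∈ Icc l r → m ≤ ‖((1 + |ξ|) ^ s : ℝ) • paperFT g ξ‖) :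
    ENNReal.ofReal (m * (r - l) ^ (1 / 2 : ℝ)) ≤ sobolevHsNorm s g := by
  have h1 : eLpNorm ((Icc l r).indicator fun _ => m) 2 volume
      = ENNReal.ofReal (m * (r - l) ^ (1 / 2 : ℝ)) := by
    rw [eLpNorm_indicator_const measurableSet_Icc (by norm_num) (by norm_num), Real.volume_Icc,
      ENNReal.ofReal_rpow_of_nonneg (by linarith) (by norm_num), ENNReal.ofReal_mul hm,
      Real.enorm_of_nonneg hm]
    norm_num
  rw [← h1, sobolevHsNorm]
  refine eLpNorm_mono_ae ?_
  filter_upwards [h] with ξ hξ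
  by_cases hm' : ξ ∈ Icc l r
  · rw [indicator_of_mem hm', Real.norm_eq_abs, abs_of_nonneg hm]
    exact hξ hm'
  · rw [indicator_of_notMem hm', norm_zero]; exact norm_nonneg _

/-- Nonexistence of a smooth flow map (cubic lower bound): for `γ ∈ {1,2,3}` and
`s < (γ-1)/2`, the third Picard iterate with data `f_N` satisfies
`sup_{0 ≤ t ≤ 1} ‖∫₀ᵗ e^{i(t-t')∂ₓ⁴} ∂ₓ^γ(|e^{it'∂ₓ⁴}f_N|² e^{it'∂ₓ⁴}f_N) dt'‖_{H^s}
  ≥ c N^{-2s+γ-1}` for all large `N`, with `c > 0` independent of `N`; in particular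
the left-hand side tends to `∞` as `N → ∞`. -/
theorem cubic_picard_iterate_lower_bound (γ : ℕ) (hγ : γ = 1 ∨ γ = 2 ∨ γ = 3)
    (s : ℝ) (hs : s < ((γ : ℝ) - 1) / 2) :
    ∃ c : ℝ, 0 < c ∧ ∃ N₀ : ℝ, ∀ N : ℝ, N₀ ≤ N →
      ENNReal.ofReal (c * N ^ (-2 * s + (γ : ℝ) - 1)) ≤
        ⨆ t ∈ Set.Icc (0 : ℝ) 1, sobolevHsNorm s (fun x => duhamelCubicN s N γ t x) := by
  set k := (Real.sqrt (2 * Real.pi))⁻¹ with hk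
  have hk0 : 0 < k := by positivity
  refine ⟨(3 : ℝ) ^ (-|s|) * (k * (2 * Real.pi) * k ^ 3) / 8000 * (1 / 2 : ℝ) ^ (1 / 2 : ℝ),
    by positivity, 1, fun N hN => ?_⟩
  have hN0 : 0 < N := by linarith
  refine le_trans ?_ (le_iSup₂_of_le (1 / 1000) (by norm_num) le_rfl)
  refine le_trans (le_of_eq ?_) (ofReal_mul_le_sobolevHsNorm (by positivity)
    (by linarith [inv_pos.2 hN0]) (ae_le_norm_rpow_smul_paperFT s hN γ))
  rw [← hk]
  congr 1
  have hpow : N ^ (-2 * s + (γ : ℝ) - 1) = N ^ s * N ^ γ * (N ^ (-s + 1 / 2)) ^ 3 * (N⁻¹) ^ 2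
      * (N⁻¹) ^ (1 / 2 : ℝ) := by
    rw [Real.inv_rpow hN0.le, ← Real.rpow_neg hN0.le, inv_pow, ← Real.rpow_natCast N 2,
      ← Real.rpow_neg hN0.le, ← Real.rpow_natCast (N ^ (-s + 1 / 2)) 3, ← Real.rpow_mul hN0.le,
      ← Real.rpow_natCast N γ, ← Real.rpow_add hN0, ← Real.rpow_add hN0, ← Real.rpow_add hN0,
      ← Real.rpow_add hN0]
    congr 1; push_cast; ring
  have hlen : (N + N⁻¹ / 2 - N) ^ (1 / 2 : ℝ) = (1 / 2 : ℝ) ^ (1 / 2 : ℝ) * (N⁻¹) ^ (1 / 2 : ℝ) := by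
    rw [← Real.mul_rpow (by norm_num) (by positivity)]
    congr 1; ring
  rw [hpow, hlen]
  ring
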